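/- (Achievability part of the IB rate-distortion theorem.) Define R'(D) := min over p_{T|X} with E[d_IB(X,T)] ≤ D of I(X;T). For every D ≥ 0 and every rate R > R'(D), there exists a sequence of (n,2^{nR}) IB-quantization codes (f_n,g_n) whose expected distortions satisfy lim sup_{n→∞} E[d̄_IB(X^n,T^n)] ≤ D. Consequently R_IBQ(D) ≤ R'(D). -/

import Mathlib

open Finset

noncomputable section

/-- `p` is a probability distribution on a finite set. -/
def IsDist {A : Type*} [Fintype A] (p : A → ℝ) : Prop :=
  (∀ a, 0 ≤ p a) ∧ ∑ a, p a = 1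

/-- `p` is a joint probability distribution on a product of finite sets (curried form). -/
def IsJoint {A B : Type*} [Fintype A] [Fintype B] (p : A → B → ℝ) : Prop :=
  (∀ a b, 0 ≤ p a b) ∧ ∑ a, ∑ b, p a b = 1

/-- `w` is a conditional probability distribution (a row-stochastic kernel). -/
def IsCond {A B : Type*} [Fintype A] [Fintype B] (w : A → B → ℝ) : Prop :=
  (∀ a b, 0 ≤ w a b) ∧ ∀ a, ∑ b, w a b = 1

/-- Mutual information (natural logarithm) of a joint distribution given in curried form. -/
def mutualInfo {A B : Type*} [Fintype A] [Fintype B] (p : A → B → ℝ) : ℝ :=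
  ∑ a, ∑ b, p a b * Real.log (p a b / ((∑ b', p a b') * (∑ a', p a' b)))

/-- Kullback–Leibler divergence (natural logarithm) between two distributions. -/
def klDiv {A : Type*} [Fintype A] (p q : A → ℝ) : ℝ :=
  ∑ a, p a * Real.log (p a / q a)

/-- Shannon entropy (natural logarithm). -/
def entropy {A : Type*} [Fintype A] (p : A → ℝ) : ℝ :=
  -∑ a, p a * Real.log (p a)

variable {𝒳 𝒴 : Type*} [Fintype 𝒳] [Fintype 𝒴]

/-- Marginal on the first component of a joint distribution. -/
def margX (p : 𝒳 → 𝒴 → ℝ) (x : 𝒳) : ℝ := ∑ y, p x y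

/-- Marginal on the second component of a joint distribution. -/
def margY (p : 𝒳 → 𝒴 → ℝ) (y : 𝒴) : ℝ := ∑ x, p x y

/-- Marginal distribution of the representation `U` induced by `p_{XY}` and `p_{U|X} = w`. -/
def pU {U : Type*} [Fintype U] (p : 𝒳 → 𝒴 → ℝ) (w : 𝒳 → U → ℝ) (u : U) : ℝ :=
  ∑ x, margX p x * w x u

/-- Joint distribution of `(Y, U)` induced by `p_{XY}` and `p_{U|X} = w`
(Markov chain `Y — X — U`). -/
def pYU {U : Type*} [Fintype U] (p : 𝒳 → 𝒴 → ℝ) (w : 𝒳 → U → ℝ) (y : 𝒴) (u : U) : ℝ :=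
  ∑ x, p x y * w x u

/-- The IB distortion `d_IB(x, u) = KL(p_{Y|X}(·|x) ‖ p_{Y|U}(·|u))`. -/
def dIB {U : Type*} [Fintype U] (p : 𝒳 → 𝒴 → ℝ) (w : 𝒳 → U → ℝ) (x : 𝒳) (u : U) : ℝ :=
  klDiv (fun y => p x y / margX p x) (fun y => pYU p w y u / pU p w u)

/-- Expected IB distortion `E[d_IB(X, U)]`. -/
def EdIB {U : Type*} [Fintype U] (p : 𝒳 → 𝒴 → ℝ) (w : 𝒳 → U → ℝ) : ℝ :=
  ∑ x, ∑ u, margX p x * w x u * dIB p w x u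

/-- Mutual information `I(X; U)` under the Markov chain `Y — X — U`. -/
def IXU {U : Type*} [Fintype U] (p : 𝒳 → 𝒴 → ℝ) (w : 𝒳 → U → ℝ) : ℝ :=
  mutualInfo (fun x u => margX p x * w x u)

/-- Mutual information `I(Y; U)` under the Markov chain `Y — X — U`. -/
def IYU {U : Type*} [Fintype U] (p : 𝒳 → 𝒴 → ℝ) (w : 𝒳 → U → ℝ) : ℝ :=
  mutualInfo (fun y u => pYU p w y u)

/-- Conditional entropy `H(Y|X)` under the joint distribution `p`. -/
def condEntropyYX (p : 𝒳 → 𝒴 → ℝ) : ℝ :=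
  -∑ x, ∑ y, p x y * Real.log (p x y / margX p x)

/-- Conditional entropy `H(Y|U)` under the joint distribution induced by `p` and `w`. -/
def condEntropyYU {U : Type*} [Fintype U] (p : 𝒳 → 𝒴 → ℝ) (w : 𝒳 → U → ℝ) : ℝ :=
  -∑ y, ∑ u, pYU p w y u * Real.log (pYU p w y u / pU p w u)

/-- Mutual information in bits (logarithm base 2) of a joint distribution in curried form. -/
def mutualInfo2 {A B : Type*} [Fintype A] [Fintype B] (p : A → B → ℝ) : ℝ :=
  ∑ a, ∑ b, p a b * Real.logb 2 (p a b / ((∑ b', p a b') * (∑ a', p a' b)))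

/-- Kullback–Leibler divergence in bits (logarithm base 2). -/
def klDiv2 {A : Type*} [Fintype A] (p q : A → ℝ) : ℝ :=
  ∑ a, p a * Real.logb 2 (p a / q a)

/-- Shannon entropy in bits (logarithm base 2). -/
def entropy2 {A : Type*} [Fintype A] (p : A → ℝ) : ℝ :=
  -∑ a, p a * Real.logb 2 (p a)

/-- The IB distortion in bits: `d_IB(x, u) = KL(p_{Y|X}(·|x) ‖ p_{Y|U}(·|u))`. -/
def dIB2 {𝒳 𝒴 U : Type*} [Fintype 𝒳] [Fintype 𝒴] [Fintype U]
    (p : 𝒳 → 𝒴 → ℝ) (w : 𝒳 → U → ℝ) (x : 𝒳) (u : U) : ℝ :=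
  klDiv2 (fun y => p x y / margX p x) (fun y => pYU p w y u / pU p w u)

/-- Expected IB distortion in bits, `E[d_IB(X, U)]`. -/
def EdIB2 {𝒳 𝒴 U : Type*} [Fintype 𝒳] [Fintype 𝒴] [Fintype U]
    (p : 𝒳 → 𝒴 → ℝ) (w : 𝒳 → U → ℝ) : ℝ :=
  ∑ x, ∑ u, margX p x * w x u * dIB2 p w x u

/-- Mutual information `I(X; U)` in bits under the Markov chain `Y — X — U`. -/
def IXU2 {𝒳 𝒴 U : Type*} [Fintype 𝒳] [Fintype 𝒴] [Fintype U]
    (p : 𝒳 → 𝒴 → ℝ) (w : 𝒳 → U → ℝ) : ℝ :=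
  mutualInfo2 (fun x u => margX p x * w x u)

/-- Mutual information `I(Y; U)` in bits under the Markov chain `Y — X — U`. -/
def IYU2 {𝒳 𝒴 U : Type*} [Fintype 𝒳] [Fintype 𝒴] [Fintype U]
    (p : 𝒳 → 𝒴 → ℝ) (w : 𝒳 → U → ℝ) : ℝ :=
  mutualInfo2 (fun y u => pYU p w y u)

section Codes

variable {𝒳 𝒴 𝒯 : Type*} [Fintype 𝒳] [Fintype 𝒴] [Fintype 𝒯] [DecidableEq 𝒯]

/-- Probability of the i.i.d. source sequence `xs = (x₁, …, xₙ)`. -/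
def pXn (p : 𝒳 → 𝒴 → ℝ) {n : ℕ} (xs : Fin n → 𝒳) : ℝ := ∏ i, margX p (xs i)

/-- Marginal distribution of `Tᵢ`, where `T^n = gₙ(fₙ(X^n))` for the code `(fₙ, gₙ)`. -/
def pTi (p : 𝒳 → 𝒴 → ℝ) {n M : ℕ} (f : (Fin n → 𝒳) → Fin M) (g : Fin M → Fin n → 𝒯)
    (i : Fin n) (t : 𝒯) : ℝ :=
  ∑ xs, if g (f xs) i = t then pXn p xs else 0

/-- Joint distribution of `(Yᵢ, Tᵢ)` induced by the code `(fₙ, gₙ)` and the i.i.d. source. -/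
def pYiTi (p : 𝒳 → 𝒴 → ℝ) {n M : ℕ} (f : (Fin n → 𝒳) → Fin M) (g : Fin M → Fin n → 𝒯)
    (i : Fin n) (y : 𝒴) (t : 𝒯) : ℝ :=
  ∑ xs, if g (f xs) i = t then pXn p xs * (p (xs i) y / margX p (xs i)) else 0

/-- The sequence IB distortion `d̄_IB(x^n, gₙ(fₙ(x^n)))`
`= (1/n) ∑ᵢ KL(p_{Yᵢ|Xᵢ}(·|xᵢ) ‖ p_{Yᵢ|Tᵢ}(·|tᵢ))` (in bits). -/
def dbar (p : 𝒳 → 𝒴 → ℝ) {n M : ℕ} (f : (Fin n → 𝒳) → Fin M) (g : Fin M → Fin n → 𝒯)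
    (xs : Fin n → 𝒳) : ℝ :=
  (n : ℝ)⁻¹ * ∑ i, klDiv2 (fun y => p (xs i) y / margX p (xs i))
    (fun y => pYiTi p f g i y (g (f xs) i) / pTi p f g i (g (f xs) i))

/-- Expected sequence IB distortion `E[d̄_IB(X^n, T^n)]` of the code `(fₙ, gₙ)`. -/
def expDist (p : 𝒳 → 𝒴 → ℝ) {n M : ℕ} (f : (Fin n → 𝒳) → Fin M) (g : Fin M → Fin n → 𝒯) : ℝ :=
  ∑ xs, pXn p xs * dbar p f g xs

/-- `(R, D)` is achievable: there is a sequence of `(n, 2^{nR})` IB-quantization codes whose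
expected distortion is asymptotically at most `D`. -/
def Achievable (𝒯 : Type*) [Fintype 𝒯] [DecidableEq 𝒯] (p : 𝒳 → 𝒴 → ℝ) (R D : ℝ) : Prop :=
  ∃ (M : ℕ → ℕ) (f : ∀ n : ℕ, (Fin n → 𝒳) → Fin (M n)) (g : ∀ n : ℕ, Fin (M n) → Fin n → 𝒯),
    (∀ n, (M n : ℝ) ≤ 2 ^ ((n : ℝ) * R)) ∧
    Filter.limsup (fun n => expDist p (f n) (g n)) Filter.atTop ≤ D

/-- The operational rate-distortion function of the IB quantization problem. -/
def RIBQ (𝒯 : Type*) [Fintype 𝒯] [DecidableEq 𝒯] (p : 𝒳 → 𝒴 → ℝ) (D : ℝ) : ℝ :=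
  sInf {R | Achievable 𝒯 p R D}

/-- The informational IB rate-distortion function
`R'(D) = min_{p_{T|X} : E[d_IB(X,T)] ≤ D} I(X;T)` (in bits). -/
def Rprime2 (𝒯 : Type*) [Fintype 𝒯] (p : 𝒳 → 𝒴 → ℝ) (D : ℝ) : ℝ :=
  sInf {r | ∃ w : 𝒳 → 𝒯 → ℝ, IsCond w ∧ EdIB2 p w ≤ D ∧ r = IXU2 p w}

end Codes

/-- Chernoff bound: sums of i.i.d. variables with negative mean are positive with
exponentially small probability. -/
lemma exists_chernoff_bound {Z : Type*} [Fintype Z] {μ : Z → ℝ} (hμ : IsDist μ) (k : Z → ℝ)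
    (hk : ∑ z, μ z * k z < 0) :
    ∃ ρ : ℝ, 0 ≤ ρ ∧ ρ < 1 ∧ ∀ n : ℕ,
      ∑ z : Fin n → Z, (∏ i, μ (z i)) * (if ∑ i, k (z i) ≤ 0 then 0 else 1) ≤ ρ ^ n := by
  set m := ∑ z, μ z * k z with hm
  set K := 1 + ∑ z, |k z| with hK
  have hK0 : 1 ≤ K := by
    have : 0 ≤ ∑ z, |k z| := sum_nonneg fun z _ => abs_nonneg _
    linarith
  have hkK : ∀ z, |k z| ≤ K := fun z => by
    have : |k z| ≤ ∑ z, |k z| :=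
      single_le_sum (f := fun z => |k z|) (fun z _ => abs_nonneg _) (mem_univ z)
    linarith
  have hmK : -m ≤ K := by
    have h1 : -m = ∑ z, μ z * (-k z) := by simp [hm]
    have h2 : ∑ z, μ z * (-k z) ≤ ∑ z, μ z * K :=
      sum_le_sum fun z _ => mul_le_mul_of_nonneg_left
        ((neg_le_abs _).trans (hkK z)) (hμ.1 z)
    rw [← sum_mul, hμ.2, one_mul] at h2
    linarith
  set s := -m / (2 * K ^ 2) with hs
  have hs0 : 0 < s := by have : 0 < -m := by linarith
                         positivity
  have hsK : s * K ≤ 1 := by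
    rw [hs, div_mul_eq_mul_div, div_le_one (by positivity)]
    nlinarith
  refine ⟨∑ z, μ z * Real.exp (s * k z),
    sum_nonneg fun z _ => mul_nonneg (hμ.1 z) (Real.exp_pos _).le, ?_, fun n => ?_⟩
  · have hexp : ∀ z, Real.exp (s * k z) ≤ 1 + s * k z + (s * K) ^ 2 := fun z => by
      have habs : |s * k z| ≤ s * K := by
        rw [abs_mul, abs_of_pos hs0]
        exact mul_le_mul_of_nonneg_left (hkK z) hs0.le
      have h1 := (abs_le.1 (Real.abs_exp_sub_one_sub_id_le (habs.trans hsK))).2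
      have h2 : (s * k z) ^ 2 ≤ (s * K) ^ 2 := by
        rw [← sq_abs]; exact pow_le_pow_left₀ (abs_nonneg _) habs 2
      linarith
    calc ∑ z, μ z * Real.exp (s * k z)
        ≤ ∑ z, μ z * (1 + s * k z + (s * K) ^ 2) :=
          sum_le_sum fun z _ => mul_le_mul_of_nonneg_left (hexp z) (hμ.1 z)
      _ = (1 + (s * K) ^ 2) * ∑ z, μ z + s * m := by
          rw [hm, mul_sum, mul_sum, ← sum_add_distrib]
          exact sum_congr rfl fun z _ => by ring
      _ = 1 + s * (s * K ^ 2 + m) := by rw [hμ.2]; ring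
      _ < 1 := by
          have : s * K ^ 2 = -m / 2 := by rw [hs]; field_simp
          rw [this]; nlinarith
  · calc ∑ z : Fin n → Z, (∏ i, μ (z i)) * (if ∑ i, k (z i) ≤ 0 then 0 else 1)
        ≤ ∑ z : Fin n → Z, ∏ i, μ (z i) * Real.exp (s * k (z i)) := by
          refine sum_le_sum fun z _ => ?_
          rw [prod_mul_distrib]
          refine mul_le_mul_of_nonneg_left ?_ (prod_nonneg fun i _ => hμ.1 _)
          rw [← Real.exp_sum, ← mul_sum]
          split_ifs with h
          · exact (Real.exp_pos _).le
          · exact Real.one_le_exp (mul_nonneg hs0.le (not_le.1 h).le)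
      _ = (∑ z, μ z * Real.exp (s * k z)) ^ n :=
          (Fintype.sum_pow (fun z => μ z * Real.exp (s * k z)) n).symm

/-- One-shot covering lemma, by random coding. -/
lemma exists_code_of_covering {X T : Type*} [Fintype X] [Fintype T] {P : X → ℝ}
    {W : X → T → ℝ} {Q : T → ℝ} (hP : IsDist P) (hW : IsCond W) (hQ : IsDist Q)
    (A : X → T → Prop)
    [∀ x t, Decidable (A x t)] {a : ℝ} (hA : ∀ x t, A x t → a * W x t ≤ Q t)
    {M : ℕ} (hM : 0 < M) :
    ∃ (f : X → Fin M) (g : Fin M → T),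
      ∑ x, P x * (if A x (g (f x)) then 0 else 1) ≤
        ∑ x, ∑ t, P x * W x t * (if A x t then 0 else 1) + Real.exp (-(a * M)) := by
  set B := ∑ x, ∑ t, P x * W x t * (if A x t then 0 else 1) + Real.exp (-(a * M)) with hB
  set F : (Fin M → T) → ℝ := fun g => ∑ x, P x * ∏ m, (if A x (g m) then 0 else 1) with hF
  suffices h : ∃ g, F g ≤ B by
    obtain ⟨g, hg⟩ := h
    refine ⟨fun x => if h : ∃ m, A x (g m) then h.choose else ⟨0, hM⟩, g, le_trans ?_ hg⟩
    refine sum_le_sum fun x _ => mul_le_mul_of_nonneg_left ?_ (hP.1 x)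
    by_cases h : ∃ m, A x (g m)
    · simp only [dif_pos h, if_pos h.choose_spec]
      exact prod_nonneg fun m _ => by split_ifs <;> norm_num
    · push Not at h
      simp [h]
  have hsum : ∑ g : Fin M → T, ∏ m, Q (g m) = 1 := by
    rw [← Fintype.sum_pow, hQ.2, one_pow]
  have hmean : ∑ g : Fin M → T, (∏ m, Q (g m)) * F g ≤ B := by
    have hswap : ∑ g : Fin M → T, (∏ m, Q (g m)) * F g
        = ∑ x, P x * (∑ t, Q t * (if A x t then 0 else 1)) ^ M := by
      simp_rw [hF, mul_sum]
      rw [sum_comm]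
      refine sum_congr rfl fun x _ => ?_
      rw [Fintype.sum_pow, mul_sum]
      refine sum_congr rfl fun g _ => ?_
      rw [prod_mul_distrib]; ring
    rw [hswap]
    have hx : ∀ x, (∑ t, Q t * (if A x t then 0 else 1)) ^ M ≤
        ∑ t, W x t * (if A x t then 0 else 1) + Real.exp (-(a * M)) := fun x => by
      set u := ∑ t, W x t * (if A x t then 1 else 0) with hu
      have hu0 : 0 ≤ u := sum_nonneg fun t _ => mul_nonneg (hW.1 x t) (by split_ifs <;> norm_num)
      have hfail : ∑ t, W x t * (if A x t then 0 else 1) = 1 - u := by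
        rw [eq_sub_iff_add_eq, hu, ← sum_add_distrib]
        refine (sum_congr rfl fun t _ => ?_).trans (hW.2 x)
        split_ifs <;> ring
      have hu1 : u ≤ 1 := by
        have : 0 ≤ ∑ t, W x t * (if A x t then 0 else 1) :=
          sum_nonneg fun t _ => mul_nonneg (hW.1 x t) (by split_ifs <;> norm_num)
        linarith
      have hQle : ∑ t, Q t * (if A x t then 0 else 1) ≤ 1 - a * u := by
        rw [le_sub_iff_add_le, hu, mul_sum, ← sum_add_distrib]
        refine (sum_le_sum fun t _ => ?_).trans hQ.2.le
        split_ifs with h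
        · have := hA x t h; linarith
        · linarith
      have hQ0 : 0 ≤ ∑ t, Q t * (if A x t then 0 else 1) :=
        sum_nonneg fun t _ => mul_nonneg (hQ.1 t) (by split_ifs <;> norm_num)
      rw [hfail]
      calc (∑ t, Q t * (if A x t then 0 else 1)) ^ M
          ≤ Real.exp (-(a * u)) ^ M := by
            refine pow_le_pow_left₀ hQ0 (hQle.trans ?_) M
            have := Real.add_one_le_exp (-(a * u)); linarith
        _ = Real.exp ((1 - u) * 0 + u * (-(a * M))) := by
            rw [← Real.exp_nat_mul]; congr 1; ring
        _ ≤ (1 - u) * Real.exp 0 + u * Real.exp (-(a * M)) :=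
            convexOn_exp.2 (Set.mem_univ _) (Set.mem_univ _) (by linarith) hu0 (by ring)
        _ ≤ 1 - u + Real.exp (-(a * M)) := by
            rw [Real.exp_zero]
            nlinarith [Real.exp_pos (-(a * M))]
    calc ∑ x, P x * (∑ t, Q t * (if A x t then 0 else 1)) ^ M
        ≤ ∑ x, P x * (∑ t, W x t * (if A x t then 0 else 1) + Real.exp (-(a * M))) :=
          sum_le_sum fun x _ => mul_le_mul_of_nonneg_left (hx x) (hP.1 x)
      _ = B := by
          simp_rw [mul_add, sum_add_distrib, ← sum_mul, hP.2, one_mul, mul_sum, hB, mul_assoc]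
  by_contra! h
  have hnn : ∀ g : Fin M → T, 0 ≤ ∏ m, Q (g m) := fun g => prod_nonneg fun m _ => hQ.1 _
  have hpos : 0 < ∑ g : Fin M → T, (∏ m, Q (g m)) * (F g - B) := by
    obtain ⟨g, -, hg⟩ := exists_ne_zero_of_sum_ne_zero (hsum.trans_ne one_ne_zero)
    exact sum_pos' (fun g _ => mul_nonneg (hnn g) (sub_pos.2 (h g)).le)
      ⟨g, mem_univ g, mul_pos ((hnn g).lt_of_ne' hg) (sub_pos.2 (h g))⟩
  simp_rw [mul_sub, sum_sub_distrib, ← sum_mul, hsum] at hpos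
  linarith

lemma IsDist.pow {Z : Type*} [Fintype Z] {μ : Z → ℝ} (hμ : IsDist μ) (n : ℕ) :
    IsDist (fun z : Fin n → Z => ∏ i, μ (z i)) :=
  ⟨fun z => prod_nonneg fun i _ => hμ.1 _, by rw [← Fintype.sum_pow, hμ.2, one_pow]⟩

lemma IsCond.pow {X T : Type*} [Fintype X] [Fintype T] {w : X → T → ℝ} (hw : IsCond w) (n : ℕ) :
    IsCond (fun (x : Fin n → X) (t : Fin n → T) => ∏ i, w (x i) (t i)) :=
  ⟨fun x t => prod_nonneg fun i _ => hw.1 _ _, fun x => by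
    have := (Finset.prod_univ_sum (fun _ : Fin n => (univ : Finset T)) (fun i t => w (x i) t)).symm
    rw [Fintype.piFinset_univ] at this
    rw [this]
    exact prod_eq_one fun i _ => hw.2 _⟩

/-- The Chernoff bound for the joint law of a source and a memoryless channel. -/
lemma exists_chernoff_bound_joint {X T : Type*} [Fintype X] [Fintype T] {P : X → ℝ}
    {w : X → T → ℝ} (hP : IsDist P) (hw : IsCond w) (k : X → T → ℝ)
    (hk : ∑ x, ∑ t, P x * w x t * k x t < 0) :
    ∃ ρ : ℝ, 0 ≤ ρ ∧ ρ < 1 ∧ ∀ n : ℕ,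
      ∑ x : Fin n → X, ∑ t : Fin n → T, (∏ i, P (x i)) * (∏ i, w (x i) (t i)) *
        (if ∑ i, k (x i) (t i) ≤ 0 then 0 else 1) ≤ ρ ^ n := by
  have hμ : IsDist (fun z : X × T => P z.1 * w z.1 z.2) :=
    ⟨fun z => mul_nonneg (hP.1 _) (hw.1 _ _), by
      simp_rw [Fintype.sum_prod_type, ← mul_sum, hw.2, mul_one, hP.2]⟩
  obtain ⟨ρ, h0, h1, h⟩ := exists_chernoff_bound hμ (fun z => k z.1 z.2)
    (by rwa [Fintype.sum_prod_type])
  refine ⟨ρ, h0, h1, fun n => le_of_eq_of_le ?_ (h n)⟩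
  rw [← Fintype.sum_prod_type',
    ← (Equiv.arrowProdEquivProdArrow (Fin n) (fun _ => X) (fun _ => T)).sum_comp]
  refine sum_congr rfl fun z _ => ?_
  simp only [Equiv.arrowProdEquivProdArrow, Equiv.coe_fn_mk, prod_mul_distrib]
  rfl

lemma mutualInfo2_eq {X T : Type*} [Fintype X] [Fintype T] {P : X → ℝ} {w : X → T → ℝ}
    (hP : ∀ x, 0 < P x) (hw : IsCond w) :
    mutualInfo2 (fun x t => P x * w x t) =
      ∑ x, ∑ t, P x * w x t * Real.logb 2 (w x t / ∑ x', P x' * w x' t) := by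
  refine sum_congr rfl fun x _ => sum_congr rfl fun t _ => ?_
  rw [← mul_sum, hw.2, mul_one, mul_div_mul_left _ _ (hP x).ne']

lemma output_pos {X T : Type*} [Fintype X] {P : X → ℝ} {w : X → T → ℝ}
    (hP : ∀ x, 0 < P x) (hw : ∀ x t, 0 ≤ w x t) {x : X} {t : T} (h : 0 < w x t) :
    0 < ∑ x', P x' * w x' t :=
  sum_pos' (fun x' _ => mul_nonneg (hP x').le (hw x' t)) ⟨x, mem_univ x, mul_pos (hP x) h⟩

lemma sub_le_mul_log_div {a b : ℝ} (ha : 0 ≤ a) (hb : 0 ≤ b) (hab : 0 < a → 0 < b) :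
    a - b ≤ a * Real.log (a / b) := by
  rcases ha.eq_or_lt with rfl | ha
  · simpa using hb
  · have hb := hab ha
    have h := Real.log_le_sub_one_of_pos (div_pos hb ha)
    have h2 : Real.log (a / b) = -Real.log (b / a) := by rw [← Real.log_inv, inv_div]
    have h3 : a * (b / a) = b := by field_simp
    rw [h2]
    nlinarith

lemma IsDist.output {X T : Type*} [Fintype X] [Fintype T] {P : X → ℝ} {w : X → T → ℝ}
    (hP : IsDist P) (hw : IsCond w) : IsDist (fun t => ∑ x, P x * w x t) :=
  ⟨fun t => sum_nonneg fun x _ => mul_nonneg (hP.1 x) (hw.1 x t), by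
    rw [sum_comm]; simp_rw [← mul_sum, hw.2, mul_one, hP.2]⟩

lemma mutualInfo2_nonneg {X T : Type*} [Fintype X] [Fintype T] {P : X → ℝ} {w : X → T → ℝ}
    (hP : IsDist P) (hP0 : ∀ x, 0 < P x) (hw : IsCond w) :
    0 ≤ mutualInfo2 (fun x t => P x * w x t) := by
  rw [mutualInfo2_eq hP0 hw]
  have hlog : 0 < Real.log 2 := Real.log_pos one_lt_two
  refine sum_nonneg fun x _ => ?_
  simp_rw [mul_assoc, ← mul_sum]
  refine mul_nonneg (hP0 x).le ?_
  have h : ∑ t, (w x t - ∑ x', P x' * w x' t) / Real.log 2 ≤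
      ∑ t, w x t * Real.logb 2 (w x t / ∑ x', P x' * w x' t) := by
    refine sum_le_sum fun t _ => ?_
    rw [Real.logb, ← mul_div_assoc]
    exact div_le_div_of_nonneg_right
      (sub_le_mul_log_div (hw.1 x t) ((hP.output hw).1 t) (output_pos hP0 hw.1)) hlog.le
  rwa [← sum_div, sum_sub_distrib, hw.2, (hP.output hw).2, sub_self, zero_div] at h

/-- Achievability for a fixed single-letter distortion measure: at rates above the mutual
information, the expected distortion of the best code approaches that of the test channel. -/
lemma eventually_exists_code {X T : Type*} [Fintype X] [Fintype T] {P : X → ℝ} {w : X → T → ℝ}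
    (hP : IsDist P) (hP0 : ∀ x, 0 < P x) (hw : IsCond w) (d : X → T → ℝ) {D R ε : ℝ}
    (hD : 0 ≤ D) (hd : ∑ x, ∑ t, P x * w x t * d x t < D)
    (hR : mutualInfo2 (fun x t => P x * w x t) < R) (hε : 0 < ε) :
    ∀ᶠ n : ℕ in Filter.atTop, ∀ M : ℕ, 0 < M → (2 : ℝ) ^ ((n : ℝ) * R) < M + 1 →
      ∃ (f : (Fin n → X) → Fin M) (g : Fin M → Fin n → T),
        ∑ x, (∏ i, P (x i)) * ((n : ℝ)⁻¹ * ∑ i, d (x i) (g (f x) i)) ≤ D + ε := by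
  classical
  set I := mutualInfo2 (fun x t => P x * w x t) with hI
  set η := (R - I) / 2 with hη
  have hη0 : 0 < η := by rw [hη]; linarith
  set q : T → ℝ := fun t => ∑ x, P x * w x t with hq
  set j : X → T → ℝ := fun x t => Real.logb 2 (w x t / q t) with hj
  have hjoint : ∑ x, ∑ t, P x * w x t = 1 := by
    simp_rw [← mul_sum, hw.2, mul_one, hP.2]
  have hshift : ∀ (h : X → T → ℝ) (c : ℝ), ∑ x, ∑ t, P x * w x t * (h x t - c) =
      ∑ x, ∑ t, P x * w x t * h x t - c := fun h c => by
    simp_rw [mul_sub, sum_sub_distrib, ← sum_mul, hjoint, one_mul]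
  obtain ⟨ρ₁, h10, h11, hρ₁⟩ := exists_chernoff_bound_joint hP hw (fun x t => d x t - D)
    (by rw [hshift]; linarith)
  obtain ⟨ρ₂, h20, h21, hρ₂⟩ := exists_chernoff_bound_joint hP hw (fun x t => j x t - (I + η))
    (by rw [hshift, ← mutualInfo2_eq hP0 hw]; linarith)
  set C := ∑ x, ∑ t, |d x t| with hC
  have hC0 : 0 ≤ C := sum_nonneg fun x _ => sum_nonneg fun t _ => abs_nonneg _
  have hdC : ∀ x t, d x t ≤ C := fun x t =>
    (le_abs_self _).trans <|
      (single_le_sum (f := fun t => |d x t|) (fun t _ => abs_nonneg _) (mem_univ t)).trans <|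
      single_le_sum (f := fun x => ∑ t, |d x t|)
        (fun x _ => sum_nonneg fun t _ => abs_nonneg _) (mem_univ x)
  have hlim : Filter.Tendsto (fun n : ℕ => C * (ρ₁ ^ n + ρ₂ ^ n +
      Real.exp (1 - (2 ^ η : ℝ) ^ n))) Filter.atTop (nhds 0) := by
    have h1 := tendsto_pow_atTop_nhds_zero_of_lt_one h10 h11
    have h2 := tendsto_pow_atTop_nhds_zero_of_lt_one h20 h21
    have h3 : Filter.Tendsto (fun n : ℕ => Real.exp (1 - (2 ^ η : ℝ) ^ n))
        Filter.atTop (nhds 0) := by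
      refine Real.tendsto_exp_atBot.comp ?_
      simp_rw [sub_eq_add_neg]
      refine Filter.tendsto_atBot_add_const_left _ _ (Filter.tendsto_neg_atTop_atBot.comp ?_)
      exact tendsto_pow_atTop_atTop_of_one_lt (Real.one_lt_rpow one_lt_two hη0)
    simpa using ((h1.add h2).add h3).const_mul C
  filter_upwards [hlim.eventually_lt_const hε, Filter.eventually_gt_atTop 0] with n hn hn0 M hM hMR
  have hnpos : (0 : ℝ) < n := Nat.cast_pos.2 hn0
  set a : ℝ := 2 ^ (-(n * (I + η))) with ha
  set A : (Fin n → X) → (Fin n → T) → Prop := fun x t =>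
    ∑ i, (d (x i) (t i) - D) ≤ 0 ∧ ∑ i, (j (x i) (t i) - (I + η)) ≤ 0 with hA
  have hAQ : ∀ x t, A x t → a * ∏ i, w (x i) (t i) ≤ ∏ i, q (t i) := by
    rintro x t ⟨-, h⟩
    by_cases hpos : ∀ i, 0 < w (x i) (t i)
    · have hqpos : ∀ i, 0 < q (t i) := fun i => output_pos hP0 hw.1 (hpos i)
      have hprod : ∏ i, w (x i) (t i) = 2 ^ (∑ i, j (x i) (t i)) * ∏ i, q (t i) := by
        rw [Real.rpow_sum_of_pos two_pos, ← prod_mul_distrib]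
        refine prod_congr rfl fun i _ => ?_
        rw [hj, Real.rpow_logb two_pos (by norm_num) (div_pos (hpos i) (hqpos i)),
          div_mul_cancel₀ _ (hqpos i).ne']
      rw [hprod, ← mul_assoc, ha, ← Real.rpow_add two_pos]
      refine mul_le_of_le_one_left (prod_nonneg fun i _ => (hqpos i).le) ?_
      refine Real.rpow_le_one_of_one_le_of_nonpos one_le_two ?_
      simp only [sum_sub_distrib, sum_const, card_univ, Fintype.card_fin, nsmul_eq_mul] at h
      linarith
    · push Not at hpos
      obtain ⟨i, hi⟩ := hpos
      rw [prod_eq_zero (mem_univ i) (le_antisymm hi (hw.1 _ _)), mul_zero]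
      exact prod_nonneg fun i _ => (hP.output hw).1 _
  obtain ⟨f, g, hfg⟩ := exists_code_of_covering (hP.pow n) (hw.pow n) ((hP.output hw).pow n) A
    hAQ hM
  refine ⟨f, g, ?_⟩
  have hfail : ∑ x : Fin n → X, ∑ t : Fin n → T, (∏ i, P (x i)) * (∏ i, w (x i) (t i)) *
      (if A x t then 0 else 1) ≤ ρ₁ ^ n + ρ₂ ^ n := by
    refine le_trans ?_ (add_le_add (hρ₁ n) (hρ₂ n))
    simp_rw [← sum_add_distrib, ← mul_add]
    refine sum_le_sum fun x _ => sum_le_sum fun t _ => mul_le_mul_of_nonneg_left ?_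
      (mul_nonneg ((hP.pow n).1 x) ((hw.pow n).1 x t))
    by_cases h1 : ∑ i, (d (x i) (t i) - D) ≤ 0 <;>
      by_cases h2 : ∑ i, (j (x i) (t i) - (I + η)) ≤ 0 <;> simp only [hA, h1, h2] <;> norm_num
  have hexp : Real.exp (-(a * M)) ≤ Real.exp (1 - (2 ^ η : ℝ) ^ n) := by
    refine Real.exp_le_exp.2 ?_
    have h0 : 0 < a := Real.rpow_pos_of_pos two_pos _
    have h1 : a ≤ 1 := by
      refine Real.rpow_le_one_of_one_le_of_nonpos one_le_two ?_
      have := mutualInfo2_nonneg hP hP0 hw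
      have : 0 ≤ n * (I + η) := by positivity
      linarith
    have h2 : a * 2 ^ ((n : ℝ) * R) = (2 ^ η : ℝ) ^ n := by
      rw [ha, ← Real.rpow_add two_pos, ← Real.rpow_natCast, ← Real.rpow_mul two_pos.le]
      congr 1; rw [hη]; ring
    nlinarith [mul_lt_mul_of_pos_left hMR h0]
  calc ∑ x, (∏ i, P (x i)) * ((n : ℝ)⁻¹ * ∑ i, d (x i) (g (f x) i))
      ≤ ∑ x, (∏ i, P (x i)) * (D + C * (if A x (g (f x)) then 0 else 1)) := by
        refine sum_le_sum fun x _ => mul_le_mul_of_nonneg_left ?_ ((hP.pow n).1 x)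
        rw [inv_mul_le_iff₀ hnpos]
        split_ifs with h
        · have := h.1
          simp only [sum_sub_distrib, sum_const, card_univ, Fintype.card_fin, nsmul_eq_mul] at this
          linarith
        · have : ∑ i, d (x i) (g (f x) i) ≤ ∑ _i : Fin n, C := sum_le_sum fun i _ => hdC _ _
          simp only [sum_const, card_univ, Fintype.card_fin, nsmul_eq_mul] at this
          nlinarith
    _ = D + C * ∑ x, (∏ i, P (x i)) * (if A x (g (f x)) then 0 else 1) := by
        simp_rw [mul_add, sum_add_distrib, ← sum_mul, (hP.pow n).2, one_mul, mul_sum]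
        congr 1
        exact sum_congr rfl fun x _ => by ring
    _ ≤ D + C * (ρ₁ ^ n + ρ₂ ^ n + Real.exp (1 - (2 ^ η : ℝ) ^ n)) := by
        gcongr
        exact hfg.trans (add_le_add hfail hexp)
    _ ≤ D + ε := by linarith

lemma IsJoint.isDist_margX {p : 𝒳 → 𝒴 → ℝ} (hp : IsJoint p) : IsDist (margX p) :=
  ⟨fun x => sum_nonneg fun y _ => hp.1 x y, hp.2⟩

/-- The induced conditionals `p_{Yᵢ|Tᵢ}` are the optimal decoders: replacing them by any other
positive (sub-)kernel `r` does not decrease the expected distortion. -/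
lemma expDist_le {T : Type*} [Fintype T] [DecidableEq T] {p : 𝒳 → 𝒴 → ℝ} (hp : IsJoint p)
    (hX : ∀ x, 0 < margX p x) {n M : ℕ} (f : (Fin n → 𝒳) → Fin M) (g : Fin M → Fin n → T)
    {r : T → 𝒴 → ℝ} (hr : ∀ t y, 0 < r t y) (hr1 : ∀ t, ∑ y, r t y ≤ 1) :
    expDist p f g ≤ ∑ xs, pXn p xs *
      ((n : ℝ)⁻¹ * ∑ i, klDiv2 (fun y => p (xs i) y / margX p (xs i)) (r (g (f xs) i))) := by
  have hlog : 0 < Real.log 2 := Real.log_pos one_lt_two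
  have hpn : ∀ xs : Fin n → 𝒳, 0 < pXn p xs := fun xs => prod_pos fun i _ => hX _
  set c : 𝒳 → 𝒴 → ℝ := fun x y => p x y / margX p x with hc
  have hc0 : ∀ x y, 0 ≤ c x y := fun x y => div_nonneg (hp.1 x y) (hX x).le
  have hc1 : ∀ x, ∑ y, c x y = 1 := fun x => by
    simp_rw [hc, ← sum_div]; exact div_self (hX x).ne'
  have hQ0 : ∀ i y t, 0 ≤ pYiTi p f g i y t := fun i y t => sum_nonneg fun xs _ => by
    split_ifs
    exacts [mul_nonneg (hpn xs).le (hc0 _ _), le_rfl]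
  have hT0 : ∀ i t, 0 ≤ pTi p f g i t := fun i t => sum_nonneg fun xs _ => by
    split_ifs
    exacts [(hpn xs).le, le_rfl]
  have hQT : ∀ i t, ∑ y, pYiTi p f g i y t = pTi p f g i t := fun i t => by
    simp only [pYiTi, pTi]
    rw [sum_comm]
    refine sum_congr rfl fun xs _ => ?_
    split_ifs
    · rw [← mul_sum]
      exact (congrArg _ (hc1 (xs i))).trans (mul_one _)
    · simp
  have hpush : ∀ i (h : 𝒴 → T → ℝ) , ∑ xs, pXn p xs * ∑ y, c (xs i) y * h y (g (f xs) i) =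
      ∑ t, ∑ y, pYiTi p f g i y t * h y t := fun i h => by
    simp_rw [pYiTi, sum_mul, ite_mul, zero_mul]
    rw [sum_congr rfl fun t _ => sum_comm, sum_comm]
    refine sum_congr rfl fun xs _ => ?_
    rw [sum_comm, mul_sum]
    refine sum_congr rfl fun y _ => ?_
    rw [sum_ite_eq univ (g (f xs) i), if_pos (mem_univ _), hc, mul_assoc]
  have hcoord : ∀ i, ∑ xs, pXn p xs * klDiv2 (c (xs i))
        (fun y => pYiTi p f g i y (g (f xs) i) / pTi p f g i (g (f xs) i)) ≤
      ∑ xs, pXn p xs * klDiv2 (c (xs i)) (r (g (f xs) i)) := fun i => by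
    set b : 𝒴 → T → ℝ := fun y t => pYiTi p f g i y t / pTi p f g i t with hb
    have hpt : ∀ xs, klDiv2 (c (xs i)) (fun y => b y (g (f xs) i)) -
        klDiv2 (c (xs i)) (r (g (f xs) i)) ≤
        ∑ y, c (xs i) y * ((r (g (f xs) i) y / b y (g (f xs) i) - 1) / Real.log 2) := fun xs => by
      rw [klDiv2, klDiv2, ← sum_sub_distrib]
      refine sum_le_sum fun y _ => ?_
      rw [← mul_sub]
      rcases (hc0 (xs i) y).eq_or_lt with h | h
      · simp [← h]
      refine mul_le_mul_of_nonneg_left ?_ h.le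
      set t := g (f xs) i with ht
      have hQpos : 0 < pYiTi p f g i y t := by
        refine sum_pos' (fun zs _ => ?_) ⟨xs, mem_univ _, ?_⟩
        · split_ifs
          exacts [mul_nonneg (hpn zs).le (hc0 _ _), le_rfl]
        · rw [if_pos rfl]; exact mul_pos (hpn xs) h
      have hTpos : 0 < pTi p f g i t := by
        rw [← hQT]
        exact sum_pos' (fun y _ => hQ0 i y t) ⟨y, mem_univ y, hQpos⟩
      have hbpos : 0 < b y t := div_pos hQpos hTpos
      rw [Real.logb, Real.logb, ← sub_div]
      refine div_le_div_of_nonneg_right ?_ hlog.le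
      rw [Real.log_div h.ne' hbpos.ne', Real.log_div h.ne' (hr t y).ne']
      have := Real.log_le_sub_one_of_pos (div_pos (hr t y) hbpos)
      rw [Real.log_div (hr t y).ne' hbpos.ne'] at this
      linarith
    rw [← sub_nonpos, ← sum_sub_distrib]
    simp_rw [← mul_sub]
    refine (sum_le_sum fun xs _ => mul_le_mul_of_nonneg_left (hpt xs) (hpn xs).le).trans ?_
    rw [hpush i (fun y t => (r t y / b y t - 1) / Real.log 2)]
    refine sum_nonpos fun t _ => ?_
    have hQr : ∀ y, pYiTi p f g i y t * (r t y / b y t) ≤ pTi p f g i t * r t y := fun y => by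
      rcases (hQ0 i y t).eq_or_lt with h | h
      · rw [← h, zero_mul]; exact mul_nonneg (hT0 i t) (hr t y).le
      · rcases (hT0 i t).eq_or_lt with h' | h'
        · simp [hb, ← h']
        · refine le_of_eq ?_
          simp only [hb]
          field_simp
    calc ∑ y, pYiTi p f g i y t * ((r t y / b y t - 1) / Real.log 2)
        = (∑ y, pYiTi p f g i y t * (r t y / b y t) - pTi p f g i t) / Real.log 2 := by
          rw [← hQT, ← sum_sub_distrib, sum_div]
          exact sum_congr rfl fun y _ => by ring
      _ ≤ 0 := by
          refine div_nonpos_of_nonpos_of_nonneg (sub_nonpos.2 ?_) hlog.le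
          refine (sum_le_sum fun y _ => hQr y).trans ?_
          rw [← mul_sum]
          exact mul_le_of_le_one_right (hT0 i t) (hr1 t)
  have hexch : ∀ k : Fin n → (Fin n → 𝒳) → ℝ, ∑ xs, pXn p xs * ((n : ℝ)⁻¹ * ∑ i, k i xs) =
      (n : ℝ)⁻¹ * ∑ i, ∑ xs, pXn p xs * k i xs := fun k => by
    rw [sum_comm, mul_sum]
    refine sum_congr rfl fun xs _ => ?_
    rw [← mul_sum]; ring
  simp only [expDist, dbar]
  rw [hexch, hexch]
  exact mul_le_mul_of_nonneg_left (sum_le_sum fun i _ => hcoord i) (by positivity)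

/-- Mixing the decoder of a test channel with the uniform distribution makes it positive while
increasing the expected distortion by at most `-logb 2 s`. -/
lemma exists_positive_decoder {T : Type*} [Fintype T] {p : 𝒳 → 𝒴 → ℝ} (hp : IsJoint p)
    (hX : ∀ x, 0 < margX p x) {w : 𝒳 → T → ℝ} (hw : IsCond w) {s : ℝ} (hs0 : 0 < s)
    (hs1 : s < 1) :
    ∃ r : T → 𝒴 → ℝ, (∀ t y, 0 < r t y) ∧ (∀ t, ∑ y, r t y ≤ 1) ∧
      ∑ x, ∑ t, margX p x * w x t * klDiv2 (fun y => p x y / margX p x) (r t) ≤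
        EdIB2 p w - Real.logb 2 s := by
  have hlog : 0 < Real.log 2 := Real.log_pos one_lt_two
  have hP := hp.isDist_margX
  set N := (Fintype.card 𝒴 : ℝ) with hN
  have hYU0 : ∀ y t, 0 ≤ pYU p w y t := fun y t =>
    sum_nonneg fun x _ => mul_nonneg (hp.1 x y) (hw.1 x t)
  have hsumYU : ∀ t, ∑ y, pYU p w y t = pU p w t := fun t => by
    simp only [pYU, pU, margX]
    rw [sum_comm]
    simp_rw [sum_mul]
  have hU0 : ∀ t, 0 ≤ pU p w t := fun t => (hP.output hw).1 t
  have hb0 : ∀ y t, 0 ≤ pYU p w y t / pU p w t := fun y t => div_nonneg (hYU0 y t) (hU0 t)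
  refine ⟨fun t y => s * (pYU p w y t / pU p w t) + (1 - s) / N, fun t y => ?_, fun t => ?_, ?_⟩
  · have : Nonempty 𝒴 := ⟨y⟩
    have hNpos : 0 < N := Nat.cast_pos.2 Fintype.card_pos
    have := hb0 y t
    have : 0 < (1 - s) / N := div_pos (by linarith) hNpos
    positivity
  · rw [sum_add_distrib, ← mul_sum, ← sum_div, hsumYU, sum_const, card_univ, nsmul_eq_mul, ← hN,
      mul_div_left_comm N]
    have h1 : pU p w t / pU p w t ≤ 1 := div_self_le_one _
    have h2 : N / N ≤ 1 := div_self_le_one _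
    nlinarith
  · have hjoint : ∑ x, ∑ t, margX p x * w x t = 1 := by
      simp_rw [← mul_sum, hw.2, mul_one, hP.2]
    have hsplit : EdIB2 p w - Real.logb 2 s =
        ∑ x, ∑ t, margX p x * w x t * (dIB2 p w x t - Real.logb 2 s) := by
      simp_rw [mul_sub, sum_sub_distrib, ← sum_mul, hjoint, one_mul, EdIB2]
    rw [hsplit]
    refine sum_le_sum fun x _ => sum_le_sum fun t _ => ?_
    rcases (hw.1 x t).eq_or_lt with h | hwpos
    · simp [← h]
    refine mul_le_mul_of_nonneg_left ?_ (mul_pos (hX x) hwpos).le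
    have hc1 : ∑ y, p x y / margX p x = 1 := by
      rw [← sum_div]; exact div_self (hX x).ne'
    have hc : Real.logb 2 s = ∑ y, p x y / margX p x * Real.logb 2 s := by
      rw [← sum_mul, hc1, one_mul]
    rw [hc, dIB2, klDiv2, klDiv2, ← sum_sub_distrib]
    refine sum_le_sum fun y _ => ?_
    rw [← mul_sub]
    rcases (hp.1 x y).eq_or_lt with h | hpos
    · simp [← h]
    have hcpos : 0 < p x y / margX p x := div_pos hpos (hX x)
    refine mul_le_mul_of_nonneg_left ?_ hcpos.le
    have hYUpos : 0 < pYU p w y t := sum_pos' (fun x _ => mul_nonneg (hp.1 x y) (hw.1 x t))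
      ⟨x, mem_univ x, mul_pos hpos hwpos⟩
    have hbpos : 0 < pYU p w y t / pU p w t :=
      div_pos hYUpos (output_pos hX hw.1 hwpos)
    rw [← Real.logb_div (div_pos hcpos hbpos).ne' hs0.ne', div_div _ _ s, mul_comm _ s]
    refine Real.logb_le_logb_of_le one_lt_two (div_pos hcpos (add_pos_of_pos_of_nonneg
      (mul_pos hs0 hbpos) (div_nonneg (by linarith) (Nat.cast_nonneg _)))) ?_
    refine div_le_div_of_nonneg_left hcpos.le (mul_pos hs0 hbpos) ?_
    exact le_add_of_nonneg_right (div_nonneg (by linarith) (Nat.cast_nonneg _))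

lemma eventually_exists_expDist_le {T : Type*} [Fintype T] [DecidableEq T] {p : 𝒳 → 𝒴 → ℝ}
    (hp : IsJoint p) (hX : ∀ x, 0 < margX p x) {w : 𝒳 → T → ℝ} (hw : IsCond w) {D R ε : ℝ}
    (hD : 0 ≤ D) (hd : EdIB2 p w ≤ D) (hR : IXU2 p w < R) (hε : 0 < ε) :
    ∀ᶠ n : ℕ in Filter.atTop, ∀ M : ℕ, 0 < M → (2 : ℝ) ^ ((n : ℝ) * R) < M + 1 →
      ∃ (f : (Fin n → 𝒳) → Fin M) (g : Fin M → Fin n → T), expDist p f g ≤ D + ε := by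
  obtain ⟨r, hr, hr1, hrd⟩ := exists_positive_decoder hp hX hw
    (s := (2 : ℝ) ^ (-(ε / 4))) (Real.rpow_pos_of_pos two_pos _)
    (Real.rpow_lt_one_of_one_lt_of_neg one_lt_two (by linarith))
  rw [Real.logb_rpow two_pos (by norm_num)] at hrd
  filter_upwards [eventually_exists_code hp.isDist_margX hX hw
    (fun x t => klDiv2 (fun y => p x y / margX p x) (r t)) (D := D + ε / 2) (ε := ε / 2)
    (by linarith) (by linarith) hR (by linarith)] with n hn M hM hMR
  obtain ⟨f, g, h⟩ := hn M hM hMR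
  exact ⟨f, g, (expDist_le hp hX f g hr hr1).trans (h.trans (by linarith))⟩

lemma limsup_le_of_forall_eventually_le {u : ℕ → ℝ} {D : ℝ} (hD : 0 ≤ D)
    (h : ∀ ε > 0, ∀ᶠ n in Filter.atTop, u n ≤ D + ε) :
    Filter.limsup u Filter.atTop ≤ D := by
  rw [Filter.limsup_eq]
  by_cases hb : BddBelow {a | ∀ᶠ n in Filter.atTop, u n ≤ a}
  · exact le_of_forall_pos_le_add fun ε hε => csInf_le hb (h ε hε)
  · rwa [Real.sInf_of_not_bddBelow hb]

lemma achievable_of_test_channel {T : Type*} [Fintype T] [DecidableEq T] {p : 𝒳 → 𝒴 → ℝ}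
    (hp : IsJoint p) (hX : ∀ x, 0 < margX p x) {w : 𝒳 → T → ℝ} (hw : IsCond w) {D R : ℝ}
    (hD : 0 ≤ D) (hd : EdIB2 p w ≤ D) (hR : IXU2 p w < R) : Achievable T p R D := by
  obtain ⟨x, -, -⟩ := exists_ne_zero_of_sum_ne_zero (hp.2.trans_ne one_ne_zero)
  obtain ⟨t, -, -⟩ := exists_ne_zero_of_sum_ne_zero ((hw.2 x).trans_ne one_ne_zero)
  have hR0 : 0 < R := (mutualInfo2_nonneg hp.isDist_margX hX hw).trans_lt hR
  set M : ℕ → ℕ := fun n => ⌊(2 : ℝ) ^ ((n : ℝ) * R)⌋₊ with hM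
  have hMpos : ∀ n, 0 < M n := fun n =>
    Nat.floor_pos.2 (Real.one_le_rpow one_le_two (by positivity))
  have hbest : ∀ n, ∃ c : ((Fin n → 𝒳) → Fin (M n)) × (Fin (M n) → Fin n → T),
      ∀ c' : ((Fin n → 𝒳) → Fin (M n)) × (Fin (M n) → Fin n → T),
        expDist p c.1 c.2 ≤ expDist p c'.1 c'.2 := fun n => by
    have : Nonempty (Fin (M n)) := ⟨⟨0, hMpos n⟩⟩
    have : Nonempty T := ⟨t⟩
    exact Finite.exists_min
      fun c : ((Fin n → 𝒳) → Fin (M n)) × (Fin (M n) → Fin n → T) => expDist p c.1 c.2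
  choose c hc using hbest
  refine ⟨M, fun n => (c n).1, fun n => (c n).2, fun n => Nat.floor_le (by positivity),
    limsup_le_of_forall_eventually_le hD fun ε hε => ?_⟩
  filter_upwards [eventually_exists_expDist_le hp hX hw hD hd hR hε] with n hn
  obtain ⟨f, g, h⟩ := hn (M n) (hMpos n) (Nat.lt_floor_add_one _)
  exact (hc n (f, g)).trans h

lemma Achievable.rate_nonneg {T : Type*} [Fintype T] [DecidableEq T] [Nonempty 𝒳]
    {p : 𝒳 → 𝒴 → ℝ} {R D : ℝ} (h : Achievable T p R D) : 0 ≤ R := by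
  obtain ⟨M, f, -, hM, -⟩ := h
  by_contra! hR
  have h1 : (2 : ℝ) ^ (((1 : ℕ) : ℝ) * R) < 1 :=
    Real.rpow_lt_one_of_one_lt_of_neg one_lt_two (by simpa using hR)
  have h2 : M 1 < 1 := by exact_mod_cast (hM 1).trans_lt h1
  have h3 := (f 1 fun _ => Classical.arbitrary 𝒳).pos
  omega

/-- **Achievability part of the IB rate-distortion theorem.**
With `R'(D) = min_{p_{T|X} : E[d_IB(X,T)] ≤ D} I(X;T)`: for every `D ≥ 0` and every rate
`R > R'(D)`, there exists a sequence of `(n, 2^{nR})` IB-quantization codes `(fₙ, gₙ)` whose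
expected distortions satisfy `limsup_{n → ∞} E[d̄_IB(X^n, T^n)] ≤ D`.
Consequently `R_IBQ(D) ≤ R'(D)`. -/
theorem ib_rate_distortion_achievability
    {𝒳 𝒴 𝒯 : Type*} [Fintype 𝒳] [Fintype 𝒴] [Fintype 𝒯] [DecidableEq 𝒯]
    (p : 𝒳 → 𝒴 → ℝ) (hp : IsJoint p) (hX : ∀ x, 0 < margX p x)
    (D : ℝ) (hD : 0 ≤ D)
    (hfeas : ∃ w : 𝒳 → 𝒯 → ℝ, IsCond w ∧ EdIB2 p w ≤ D) :
    (∀ R : ℝ, Rprime2 𝒯 p D < R →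
      ∃ (M : ℕ → ℕ) (f : ∀ n : ℕ, (Fin n → 𝒳) → Fin (M n))
        (g : ∀ n : ℕ, Fin (M n) → Fin n → 𝒯),
        (∀ n, (M n : ℝ) ≤ 2 ^ ((n : ℝ) * R)) ∧
        Filter.limsup (fun n => expDist p (f n) (g n)) Filter.atTop ≤ D) ∧
    RIBQ 𝒯 p D ≤ Rprime2 𝒯 p D := by
  have hach : ∀ R : ℝ, Rprime2 𝒯 p D < R → Achievable 𝒯 p R D := fun R hR => by
    obtain ⟨w₀, hw₀, hd₀⟩ := hfeas
    obtain ⟨_, ⟨w, hw, hd, rfl⟩, hlt⟩ := exists_lt_of_csInf_lt (by exact ⟨_, w₀, hw₀, hd₀, rfl⟩) hR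
    exact achievable_of_test_channel hp hX hw hD hd hlt
  refine ⟨hach, le_of_forall_gt_imp_ge_of_dense fun R hR => ?_⟩
  obtain ⟨x, -, -⟩ := exists_ne_zero_of_sum_ne_zero (hp.2.trans_ne one_ne_zero)
  have : Nonempty 𝒳 := ⟨x⟩
  exact csInf_le ⟨0, fun R' hR' => Achievable.rate_nonneg hR'⟩ (hach R hR)
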